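/- arXiv:2002.06404 — 2 statements merged into one kernel-verified Lean document; each statement's English description precedes it below -/
import Mathlib

section
/- With the setup of the preceding statement (N ⊆ R^s a submodule, F ∈ R^{r×s}, G a minimal ≤-Gröbner basis of Syz_N(F) with leading monomials μ_i, λ a K-linear functional on R^s with ker(λ) ∩ N an R-module and (λ(g₁),…,λ(g_k)) ≠ 0, and E the elementary matrix with pivot π and constants λ_i = −λ(g_i)/λ(g_π), α_j = λ(X_jg_π)/λ(g_π)): one has ⟨EG⟩ = Syz_{ker(λ)∩N}(F). Moreover, letting j₁ < … < j_ℓ be the indices j with X_jμ_π ∉ ⟨μ_i : i ≠ π⟩ and Q the submatrix of E with rows ε_i + λ_iε_π (i ≠ π) and (X_{j_s} − α_{j_s})ε_π (s = 1,…,ℓ), the product QG is a minimal ≤-Gröbner basis of Syz_{ker(λ)∩N}(F), and its list of ≤-leading monomials is (μ₁,…,μ_{π−1}, X_{j₁}μ_π,…,X_{j_ℓ}μ_π, μ_{π+1},…,μ_k). -/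
open MvPolynomial

/-! ### Monomials of the free module `R^r`, monomial orders, Gröbner bases

Here `R = K[X₁,…,Xₙ]` is `MvPolynomial (Fin n) K` and the free module `R^r`
is `Fin r → MvPolynomial (Fin n) K` (row vectors).  A monomial `ν eᵢ` of `R^r`
is encoded as a pair `(ν, i)`. -/

/-- A monomial of the free module `R^r`: an exponent vector in `n` variables
together with the index of the coordinate vector supporting it. -/
abbrev ModMon (n r : ℕ) := (Fin n →₀ ℕ) × Fin r

/-- Multiplication of a module monomial by a ring monomial. -/
noncomputable def smulMon {n r : ℕ} (ν : Fin n →₀ ℕ) (μ : ModMon n r) : ModMon n r :=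
  (ν + μ.1, μ.2)

/-- A monomial order on `R^r`: a total order on the monomials of `R^r` such that
`μ₁ ≤ μ₂` implies `μ₁ ≤ ν·μ₁ ≤ ν·μ₂` for every ring monomial `ν`. -/
structure ModMonomialOrder (n r : ℕ) where
  le : ModMon n r → ModMon n r → Prop
  le_refl : ∀ a, le a a
  le_trans : ∀ a b c, le a b → le b c → le a c
  le_antisymm : ∀ a b, le a b → le b a → a = b
  le_total : ∀ a b, le a b ∨ le b a
  compat : ∀ (ν : Fin n →₀ ℕ) (a b : ModMon n r),
    le a b → le a (smulMon ν a) ∧ le (smulMon ν a) (smulMon ν b)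

/-- The strict order associated with a monomial order. -/
def ModMonomialOrder.lt {n r : ℕ} (ord : ModMonomialOrder n r)
    (a b : ModMon n r) : Prop :=
  ord.le a b ∧ a ≠ b

/-- The module monomial `μ = ν eᵢ` as an element of `R^r`. -/
noncomputable def monElem (K : Type) [Field K] {n r : ℕ} (μ : ModMon n r) :
    Fin r → MvPolynomial (Fin n) K :=
  Pi.single μ.2 (monomial μ.1 (1 : K))

/-- `μ` is the `ord`-leading monomial of `p ∈ R^r`: it appears in `p` and every
monomial appearing in `p` is `≤ μ`. -/
def IsLM {K : Type} [Field K] {n r : ℕ} (ord : ModMonomialOrder n r)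
    (p : Fin r → MvPolynomial (Fin n) K) (μ : ModMon n r) : Prop :=
  coeff μ.1 (p μ.2) ≠ 0 ∧
  ∀ (m : Fin n →₀ ℕ) (i : Fin r), coeff m (p i) ≠ 0 → ord.le (m, i) μ

/-- Divisibility of module monomials: `μ ∣ μ'` iff `μ' = ν·μ` for a ring monomial `ν`. -/
def monDvd {n r : ℕ} (μ μ' : ModMon n r) : Prop :=
  ∃ ν : Fin n →₀ ℕ, smulMon ν μ = μ'

/-- The `ord`-leading module of a submodule `M ⊆ R^r`: the submodule generated by
the leading monomials of the nonzero elements of `M`. -/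
noncomputable def leadingSubmodule {K : Type} [Field K] {n r : ℕ}
    (ord : ModMonomialOrder n r)
    (M : Submodule (MvPolynomial (Fin n) K) (Fin r → MvPolynomial (Fin n) K)) :
    Submodule (MvPolynomial (Fin n) K) (Fin r → MvPolynomial (Fin n) K) :=
  Submodule.span (MvPolynomial (Fin n) K)
    {v | ∃ p ∈ M, ∃ μ : ModMon n r, IsLM ord p μ ∧ v = monElem K μ}

/-- `G` is a `ord`-Gröbner basis of `M`. -/
def IsGB {K : Type} [Field K] {n r : ℕ} {ι : Type} (ord : ModMonomialOrder n r)
    (M : Submodule (MvPolynomial (Fin n) K) (Fin r → MvPolynomial (Fin n) K))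
    (G : ι → Fin r → MvPolynomial (Fin n) K) : Prop :=
  (∀ i, G i ∈ M) ∧
  leadingSubmodule ord M =
    Submodule.span (MvPolynomial (Fin n) K)
      {v | ∃ (i : ι) (μ : ModMon n r), IsLM ord (G i) μ ∧ v = monElem K μ}

/-- `G` is a minimal `ord`-Gröbner basis of `M`: no leading monomial of an element
divides that of another element. -/
def IsMinimalGB {K : Type} [Field K] {n r : ℕ} {ι : Type} (ord : ModMonomialOrder n r)
    (M : Submodule (MvPolynomial (Fin n) K) (Fin r → MvPolynomial (Fin n) K))
    (G : ι → Fin r → MvPolynomial (Fin n) K) : Prop :=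
  IsGB ord M G ∧
  ∀ (i j : ι), i ≠ j → ∀ (μi μj : ModMon n r),
    IsLM ord (G i) μi → IsLM ord (G j) μj → ¬ monDvd μi μj

/-- `G` is the reduced `ord`-Gröbner basis of `M`: minimal, leading coefficients `1`,
and no term of `G i` is divisible by the leading monomial of `G j` for `j ≠ i`. -/
def IsReducedGB {K : Type} [Field K] {n r : ℕ} {ι : Type} (ord : ModMonomialOrder n r)
    (M : Submodule (MvPolynomial (Fin n) K) (Fin r → MvPolynomial (Fin n) K))
    (G : ι → Fin r → MvPolynomial (Fin n) K) : Prop :=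
  IsMinimalGB ord M G ∧
  (∀ (i : ι) (μi : ModMon n r), IsLM ord (G i) μi → coeff μi.1 (G i μi.2) = 1) ∧
  (∀ (i j : ι), i ≠ j → ∀ (μj : ModMon n r), IsLM ord (G j) μj →
    ∀ (m : Fin n →₀ ℕ) (l : Fin r), coeff m (G i l) ≠ 0 → ¬ monDvd μj (m, l))

/-- The rows of the elementary matrix `E ∈ R^{(k+n-1)×k}` with pivot `π`,
constants `lam i` (for `i ≠ π`) and `α j`: the rows `εᵢ + λᵢ ε_π` for `i ≠ π`
and `(Xⱼ - αⱼ) ε_π` for `1 ≤ j ≤ n`. -/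
noncomputable def elemRow {K : Type} [Field K] {n k : ℕ} (π : Fin k)
    (lam : Fin k → K) (α : Fin n → K) :
    ({i : Fin k // i ≠ π} ⊕ Fin n) → Fin k → MvPolynomial (Fin n) K :=
  Sum.elim
    (fun i => Pi.single i.1 (1 : MvPolynomial (Fin n) K)
      + lam i.1 • (Pi.single π 1 : Fin k → MvPolynomial (Fin n) K))
    (fun j => (X j - C (α j)) • (Pi.single π 1 : Fin k → MvPolynomial (Fin n) K))

/-- Rows of the matrix product `E·G` where `E` has rows in `R^k` indexed by `ι`
and `G ∈ R^{k×r}`. -/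
noncomputable def rowMul {K : Type} [Field K] {n k r : ℕ} {ι : Type}
    (E : ι → Fin k → MvPolynomial (Fin n) K)
    (G : Fin k → Fin r → MvPolynomial (Fin n) K) :
    ι → Fin r → MvPolynomial (Fin n) K :=
  fun a c => ∑ b, E a b * G b c

/-- `sord` is a Schreyer order for `ord` and the list of monomials `LM`. -/
def IsSchreyerOrder {n r k : ℕ} (ord : ModMonomialOrder n r)
    (LM : Fin k → ModMon n r) (sord : ModMonomialOrder n k) : Prop :=
  ∀ (ν₁ ν₂ : Fin n →₀ ℕ) (i j : Fin k),
    ord.lt (smulMon ν₁ (LM i)) (smulMon ν₂ (LM j)) → sord.le (ν₁, i) (ν₂, j)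

/-- Row vector times matrix, as a linear map `R^r → R^s`. -/
noncomputable def vecMulLin {K : Type} [Field K] {n r s : ℕ}
    (F : Fin r → Fin s → MvPolynomial (Fin n) K) :
    (Fin r → MvPolynomial (Fin n) K) →ₗ[MvPolynomial (Fin n) K]
      (Fin s → MvPolynomial (Fin n) K) :=
  Matrix.vecMulLinear (Matrix.of F)

/-- The syzygy module `Syz_N(F) = {p ∈ R^r : pF ∈ N}`. -/
noncomputable def Syz {K : Type} [Field K] {n r s : ℕ}
    (N : Submodule (MvPolynomial (Fin n) K) (Fin s → MvPolynomial (Fin n) K))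
    (F : Fin r → Fin s → MvPolynomial (Fin n) K) :
    Submodule (MvPolynomial (Fin n) K) (Fin r → MvPolynomial (Fin n) K) :=
  Submodule.comap (vecMulLin F) N

/-- `keepIdx K μ π j` holds iff `Xⱼ·μ_π` does not belong to the submodule of `R^r`
generated by the monomials `μ i`, `i ≠ π`. -/
def keepIdx (K : Type) [Field K] {n r k : ℕ} (μ : Fin k → ModMon n r) (π : Fin k)
    (j : Fin n) : Prop :=
  monElem K (smulMon (Finsupp.single j 1) (μ π)) ∉
    Submodule.span (MvPolynomial (Fin n) K)
      {v | ∃ i : Fin k, i ≠ π ∧ v = monElem K (μ i)}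

/-- The rows of the submatrix of the elementary matrix with pivot `π` keeping,
among the rows `(Xⱼ - αⱼ) ε_π`, only those with `P j`. -/
noncomputable def prunedRow {K : Type} [Field K] {n k : ℕ} (π : Fin k)
    (lam : Fin k → K) (α : Fin n → K) (P : Fin n → Prop) :
    ({i : Fin k // i ≠ π} ⊕ {j : Fin n // P j}) → Fin k → MvPolynomial (Fin n) K :=
  Sum.elim
    (fun i => Pi.single i.1 (1 : MvPolynomial (Fin n) K)
      + lam i.1 • (Pi.single π 1 : Fin k → MvPolynomial (Fin n) K))
    (fun j => (X j.1 - C (α j.1)) • (Pi.single π 1 : Fin k → MvPolynomial (Fin n) K))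

/-! ### Monomial orders and leading monomials -/

lemma ModMonomialOrder.wellFounded_lt {n r : ℕ} (ord : ModMonomialOrder n r) :
    WellFounded ord.lt := by
  have hwqo : WellQuasiOrdered
      (fun a b : ModMon n r => a.1 ≤ b.1 ∧ a.2 = b.2) :=
    WellQuasiOrdered.prod (wellQuasiOrdered_le (α := Fin n →₀ ℕ))
      (Finite.wellQuasiOrdered (α := Fin r) (· = ·))
  have : IsTrans (ModMon n r) ord.lt :=
    ⟨fun a b c hab hbc => ⟨ord.le_trans _ _ _ hab.1 hbc.1, fun hac =>
      hab.2 (ord.le_antisymm _ _ hab.1 (hac ▸ hbc.1))⟩⟩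
  have : Std.Irrefl ord.lt := ⟨fun a h => h.2 rfl⟩
  have : IsStrictOrder (ModMon n r) ord.lt := {}
  rw [RelEmbedding.wellFounded_iff_isEmpty]
  refine ⟨fun f => ?_⟩
  obtain ⟨a, b, hab, hle, heq⟩ := hwqo f
  have hlt : ord.lt (f b) (f a) := f.map_rel_iff.2 hab
  have hmul : smulMon ((f b).1 - (f a).1) (f a) = f b :=
    Prod.ext (tsub_add_cancel_of_le hle) heq
  have := (ord.compat ((f b).1 - (f a).1) _ _ (ord.le_refl (f a))).1
  rw [hmul] at this
  exact hlt.2 (ord.le_antisymm _ _ hlt.1 this)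

lemma ModMonomialOrder.le_of_monDvd {n r : ℕ} (ord : ModMonomialOrder n r)
    {a b : ModMon n r} (h : monDvd a b) : ord.le a b := by
  obtain ⟨ν, rfl⟩ := h
  exact (ord.compat ν _ _ (ord.le_refl a)).1

lemma monDvd_trans {n r : ℕ} {a b c : ModMon n r} (hab : monDvd a b) (hbc : monDvd b c) :
    monDvd a c := by
  obtain ⟨ν, rfl⟩ := hab
  obtain ⟨ν', rfl⟩ := hbc
  exact ⟨ν' + ν, by simp [smulMon, add_assoc]⟩

lemma IsLM.unique {K : Type} [Field K] {n r : ℕ} {ord : ModMonomialOrder n r}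
    {p : Fin r → MvPolynomial (Fin n) K} {μ μ' : ModMon n r}
    (h : IsLM ord p μ) (h' : IsLM ord p μ') : μ = μ' :=
  ord.le_antisymm _ _ (h'.2 _ _ h.1) (h.2 _ _ h'.1)

lemma ModMonomialOrder.exists_greatest {n r : ℕ} (ord : ModMonomialOrder n r)
    {s : Finset (ModMon n r)} (hs : s.Nonempty) : ∃ m ∈ s, ∀ x ∈ s, ord.le x m := by
  induction hs using Finset.Nonempty.cons_induction with
  | singleton a => exact ⟨a, by simp, by simpa using ord.le_refl a⟩
  | cons a s ha hs ih =>
    obtain ⟨m, hm, hmax⟩ := ih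
    rcases ord.le_total a m with h | h
    · exact ⟨m, by simp [hm], by simpa using ⟨h, fun x i hx => hmax _ hx⟩⟩
    · exact ⟨a, by simp, by
        simpa using ⟨ord.le_refl a, fun x i hx => ord.le_trans _ _ _ (hmax _ hx) h⟩⟩

lemma exists_isLM {K : Type} [Field K] {n r : ℕ} (ord : ModMonomialOrder n r)
    {p : Fin r → MvPolynomial (Fin n) K} (hp : p ≠ 0) : ∃ μ, IsLM ord p μ := by
  classical
  let s : Finset (ModMon n r) :=
    Finset.univ.biUnion fun i => (p i).support.image fun m => (m, i)
  have mem_s : ∀ a : ModMon n r, a ∈ s ↔ coeff a.1 (p a.2) ≠ 0 := by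
    rintro ⟨m, i⟩
    simp [s]
  obtain ⟨i, hi⟩ := Function.ne_iff.1 hp
  obtain ⟨m, hm⟩ := MvPolynomial.ne_zero_iff.1 hi
  obtain ⟨a, ha, hmax⟩ := ord.exists_greatest ⟨(m, i), (mem_s _).2 hm⟩
  exact ⟨a, (mem_s a).1 ha, fun m i h => hmax _ ((mem_s (m, i)).2 h)⟩

lemma exists_monDvd_of_mem_span {K : Type} [Field K] {n r : ℕ} {T : Set (ModMon n r)}
    {v : Fin r → MvPolynomial (Fin n) K}
    (hv : v ∈ Submodule.span (MvPolynomial (Fin n) K) (monElem K '' T)) :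
    ∀ (m : Fin n →₀ ℕ) (i : Fin r), coeff m (v i) ≠ 0 → ∃ τ ∈ T, monDvd τ (m, i) := by
  classical
  induction hv using Submodule.span_induction with
  | mem x hx =>
    obtain ⟨τ, hτ, rfl⟩ := hx
    intro m i h
    refine ⟨τ, hτ, 0, ?_⟩
    by_cases hi : i = τ.2
    · subst hi
      simp only [monElem, Pi.single_eq_same, coeff_monomial, ne_eq, ite_eq_right_iff,
        one_ne_zero, imp_false, not_not] at h
      simp [smulMon, h]
    · simp [monElem, hi] at h
  | zero => simp
  | add x y _ _ hx hy =>
    intro m i h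
    rw [Pi.add_apply, coeff_add] at h
    by_cases h' : coeff m (x i) = 0
    · exact hy m i (by simpa [h'] using h)
    · exact hx m i h'
  | smul f x _ hx =>
    intro m i h
    rw [Pi.smul_apply, smul_eq_mul, coeff_mul] at h
    obtain ⟨⟨a, b⟩, hab, hne⟩ := Finset.exists_ne_zero_of_sum_ne_zero h
    obtain ⟨τ, hτ, hdvd⟩ := hx b i (right_ne_zero_of_mul hne)
    refine ⟨τ, hτ, monDvd_trans hdvd ⟨a, ?_⟩⟩
    simpa [smulMon] using hab

lemma exists_monDvd_of_monElem_mem_span {K : Type} [Field K] {n r : ℕ}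
    {T : Set (ModMon n r)} {ρ : ModMon n r}
    (h : monElem K ρ ∈ Submodule.span (MvPolynomial (Fin n) K) (monElem K '' T)) :
    ∃ τ ∈ T, monDvd τ ρ :=
  exists_monDvd_of_mem_span h ρ.1 ρ.2 (by simp [monElem])

lemma monElem_smulMon (K : Type) [Field K] {n r : ℕ} (ν : Fin n →₀ ℕ) (ρ : ModMon n r) :
    monElem K (smulMon ν ρ) = monomial ν (1 : K) • monElem K ρ := by
  ext1 i
  by_cases hi : i = ρ.2
  · subst hi
    simp [monElem, smulMon, monomial_mul]
  · simp [monElem, smulMon, hi]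

lemma isGB_of_forall_exists_monDvd {K : Type} [Field K] {n r : ℕ} {ι : Type}
    {ord : ModMonomialOrder n r}
    {M : Submodule (MvPolynomial (Fin n) K) (Fin r → MvPolynomial (Fin n) K)}
    {G : ι → Fin r → MvPolynomial (Fin n) K} {μ : ι → ModMon n r}
    (hμ : ∀ i, IsLM ord (G i) (μ i)) (hGM : ∀ i, G i ∈ M)
    (hdvd : ∀ p ∈ M, ∀ ρ, IsLM ord p ρ → ∃ i, monDvd (μ i) ρ) : IsGB ord M G := by
  refine ⟨hGM, le_antisymm (Submodule.span_le.2 ?_) (Submodule.span_mono ?_)⟩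
  · rintro _ ⟨p, hp, ρ, hρ, rfl⟩
    obtain ⟨i, ν, rfl⟩ := hdvd p hp ρ hρ
    rw [monElem_smulMon]
    exact Submodule.smul_mem _ _ (Submodule.subset_span ⟨i, μ i, hμ i, rfl⟩)
  · rintro _ ⟨i, ρ, hρ, rfl⟩
    exact ⟨G i, hGM i, ρ, hρ, rfl⟩

lemma IsGB.exists_monDvd {K : Type} [Field K] {n r : ℕ} {ι : Type}
    {ord : ModMonomialOrder n r}
    {M : Submodule (MvPolynomial (Fin n) K) (Fin r → MvPolynomial (Fin n) K)}
    {G : ι → Fin r → MvPolynomial (Fin n) K} (hG : IsGB ord M G) {μ : ι → ModMon n r}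
    (hμ : ∀ i, IsLM ord (G i) (μ i)) {p : Fin r → MvPolynomial (Fin n) K} (hp : p ∈ M)
    {ρ : ModMon n r} (hρ : IsLM ord p ρ) : ∃ i, monDvd (μ i) ρ := by
  have hset : {v | ∃ (i : ι) (τ : ModMon n r), IsLM ord (G i) τ ∧ v = monElem K τ} =
      monElem K '' Set.range μ := by
    ext v
    constructor
    · rintro ⟨i, τ, hτ, rfl⟩
      exact ⟨τ, ⟨i, (hμ i).unique hτ⟩, rfl⟩
    · rintro ⟨_, ⟨i, rfl⟩, rfl⟩
      exact ⟨i, μ i, hμ i, rfl⟩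
  have hmem : monElem K ρ ∈ leadingSubmodule ord M :=
    Submodule.subset_span ⟨p, hp, ρ, hρ, rfl⟩
  rw [hG.2, hset] at hmem
  obtain ⟨_, ⟨i, rfl⟩, hi⟩ := exists_monDvd_of_monElem_mem_span hmem
  exact ⟨i, hi⟩

/-- If the leading monomials of `G` divide those of all elements of `M`, then any additive
subgroup containing the term multiples of the `G i` with leading monomial in a lower set `D`
contains all elements of `M` with leading monomial in `D`. -/
lemma mem_addSubgroup_of_forall_exists_monDvd {K : Type} [Field K] {n r : ℕ} {ι : Type}
    {ord : ModMonomialOrder n r}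
    {M : Submodule (MvPolynomial (Fin n) K) (Fin r → MvPolynomial (Fin n) K)}
    {G : ι → Fin r → MvPolynomial (Fin n) K} {μ : ι → ModMon n r}
    (hμ : ∀ i, IsLM ord (G i) (μ i)) (hGM : ∀ i, G i ∈ M)
    (hdvd : ∀ p ∈ M, ∀ ρ, IsLM ord p ρ → ∃ i, monDvd (μ i) ρ)
    {D : ModMon n r → Prop} (hD : ∀ a b, ord.le a b → D b → D a)
    {A : AddSubgroup (Fin r → MvPolynomial (Fin n) K)}
    (hA : ∀ (i : ι) (ν : Fin n →₀ ℕ) (c : K), D (smulMon ν (μ i)) → monomial ν c • G i ∈ A)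
    (ρ : ModMon n r) (hρ : D ρ) :
    ∀ p ∈ M, IsLM ord p ρ → p ∈ A := by
  induction ρ using ord.wellFounded_lt.induction with
  | _ ρ ih =>
    intro p hp hpρ
    obtain ⟨i, ν, rfl⟩ := hdvd p hp ρ hpρ
    set c := coeff (ν + (μ i).1) (p (μ i).2) / coeff (μ i).1 (G i (μ i).2) with hc
    have hcG : monomial ν c • G i ∈ A := hA i ν c hρ
    suffices h : p - monomial ν c • G i ∈ A by
      simpa using A.add_mem h hcG
    by_cases h0 : p - monomial ν c • G i = 0
    · rw [h0]
      exact A.zero_mem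
    obtain ⟨ρ', hρ'⟩ := exists_isLM ord h0
    have hle : ord.le ρ' (smulMon ν (μ i)) := by
      have h1 := hρ'.1
      rw [Pi.sub_apply, coeff_sub, Pi.smul_apply, smul_eq_mul, coeff_monomial_mul'] at h1
      by_cases h2 : coeff ρ'.1 (p ρ'.2) = 0
      · rw [h2] at h1
        split_ifs at h1 with hν
        · have h3 := (hμ i).2 (ρ'.1 - ν) ρ'.2 (by
            intro h; simp [h] at h1)
          have h4 := (ord.compat ν _ _ h3).2
          simpa [smulMon, add_tsub_cancel_of_le hν] using h4
        · simp at h1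
      · exact hpρ.2 _ _ h2
    have hne : ρ' ≠ smulMon ν (μ i) := by
      rintro rfl
      apply hρ'.1
      simp only [smulMon, Pi.sub_apply, coeff_sub, Pi.smul_apply, smul_eq_mul,
        coeff_monomial_mul]
      rw [hc, div_mul_cancel₀ _ (hμ i).1, sub_self]
    exact ih ρ' ⟨hle, hne⟩ (hD _ _ hle hρ) _ (M.sub_mem hp (M.smul_mem _ (hGM i))) hρ'

lemma span_range_eq_of_forall_exists_monDvd {K : Type} [Field K] {n r : ℕ} {ι : Type}
    {ord : ModMonomialOrder n r}
    {M : Submodule (MvPolynomial (Fin n) K) (Fin r → MvPolynomial (Fin n) K)}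
    {G : ι → Fin r → MvPolynomial (Fin n) K} {μ : ι → ModMon n r}
    (hμ : ∀ i, IsLM ord (G i) (μ i)) (hGM : ∀ i, G i ∈ M)
    (hdvd : ∀ p ∈ M, ∀ ρ, IsLM ord p ρ → ∃ i, monDvd (μ i) ρ) :
    Submodule.span (MvPolynomial (Fin n) K) (Set.range G) = M := by
  refine le_antisymm (Submodule.span_le.2 (Set.range_subset_iff.2 hGM)) fun p hp => ?_
  by_cases h0 : p = 0
  · rw [h0]
    exact Submodule.zero_mem _
  obtain ⟨ρ, hρ⟩ := exists_isLM ord h0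
  exact mem_addSubgroup_of_forall_exists_monDvd hμ hGM hdvd (D := fun _ => True)
    (fun _ _ _ _ => trivial)
    (A := (Submodule.span (MvPolynomial (Fin n) K) (Set.range G)).toAddSubgroup)
    (fun i ν c _ => Submodule.smul_mem _ _ (Submodule.subset_span ⟨i, rfl⟩))
    ρ trivial p hp hρ

lemma IsLM.add_smul {K : Type} [Field K] {n r : ℕ} {ord : ModMonomialOrder n r}
    {p q : Fin r → MvPolynomial (Fin n) K} {μ μ' : ModMon n r}
    (hp : IsLM ord p μ) (hq : IsLM ord q μ') {c : K} (h : c ≠ 0 → ord.lt μ' μ) :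
    IsLM ord (p + c • q) μ := by
  by_cases hc : c = 0
  · simpa [hc] using hp
  have hlt := h hc
  constructor
  · have : coeff μ.1 (q μ.2) = 0 := by
      by_contra h'
      exact hlt.2 (ord.le_antisymm _ _ hlt.1 (hq.2 _ _ h'))
    simpa [this] using hp.1
  · intro m i hm
    by_cases h1 : coeff m (p i) = 0
    · refine ord.le_trans _ _ _ (hq.2 m i ?_) hlt.1
      intro h2
      simp [h1, h2] at hm
    · exact hp.2 _ _ h1

lemma IsLM.X_sub_C_smul {K : Type} [Field K] {n r : ℕ} {ord : ModMonomialOrder n r}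
    {p : Fin r → MvPolynomial (Fin n) K} {μ : ModMon n r} (hp : IsLM ord p μ)
    (j : Fin n) (a : K) :
    IsLM ord ((X j - C a : MvPolynomial (Fin n) K) • p)
      (smulMon (Finsupp.single j 1) μ) := by
  have hle := (ord.compat (Finsupp.single j 1) _ _ (ord.le_refl μ)).1
  constructor
  · have : coeff (Finsupp.single j 1 + μ.1) (p μ.2) = 0 := by
      by_contra h
      have h1 := congrArg (fun x : ModMon n r => x.1 j)
        (ord.le_antisymm _ _ hle (hp.2 _ _ h))
      simp [smulMon] at h1
    simpa [smulMon, sub_mul, coeff_X_mul, coeff_C_mul, this] using hp.1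
  · intro m i hm
    by_cases h1 : coeff m (p i) = 0
    · classical
      simp only [Pi.smul_apply, smul_eq_mul, sub_mul, coeff_sub, coeff_C_mul, h1, mul_zero,
        sub_zero, X, coeff_monomial_mul', one_mul, ne_eq, ite_eq_right_iff,
        Classical.not_imp] at hm
      have h2 := (ord.compat (Finsupp.single j 1) _ _ (hp.2 _ _ hm.2)).2
      simpa [smulMon, add_tsub_cancel_of_le hm.1] using h2
    · exact ord.le_trans _ _ _ (hp.2 _ _ h1) hle

/-! ### Products with elementary matrices -/

lemma rowMul_elemRow_inl {K : Type} [Field K] {n k r : ℕ} (π : Fin k) (c : Fin k → K)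
    (α : Fin n → K) (G : Fin k → Fin r → MvPolynomial (Fin n) K) (i : {i : Fin k // i ≠ π}) :
    rowMul (elemRow π c α) G (Sum.inl i) = G i.1 + c i.1 • G π := by
  ext1 l
  simp [rowMul, elemRow, Pi.single_apply, add_mul, Finset.sum_add_distrib]

lemma rowMul_elemRow_inr {K : Type} [Field K] {n k r : ℕ} (π : Fin k) (c : Fin k → K)
    (α : Fin n → K) (G : Fin k → Fin r → MvPolynomial (Fin n) K) (j : Fin n) :
    rowMul (elemRow π c α) G (Sum.inr j) = (X j - C (α j) : MvPolynomial (Fin n) K) • G π := by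
  ext1 l
  simp [rowMul, elemRow, Pi.single_apply]

lemma rowMul_prunedRow {K : Type} [Field K] {n k r : ℕ} (π : Fin k) (c : Fin k → K)
    (α : Fin n → K) (P : Fin n → Prop) (G : Fin k → Fin r → MvPolynomial (Fin n) K)
    (a : {i : Fin k // i ≠ π} ⊕ {j : Fin n // P j}) :
    rowMul (prunedRow π c α P) G a =
      rowMul (elemRow π c α) G (Sum.map id Subtype.val a) := by
  cases a <;> rfl

lemma exists_monDvd_of_not_keepIdx {K : Type} [Field K] {n r k : ℕ} {μ : Fin k → ModMon n r}
    {π : Fin k} {j : Fin n} (h : ¬ keepIdx K μ π j) :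
    ∃ i, i ≠ π ∧ monDvd (μ i) (smulMon (Finsupp.single j 1) (μ π)) := by
  have hset : {v | ∃ i : Fin k, i ≠ π ∧ v = monElem K (μ i)} =
      monElem K '' (μ '' {i | i ≠ π}) := by
    rw [Set.image_image]
    ext v
    simp only [Set.mem_ofPred_eq, Set.mem_image, eq_comm (a := v)]
  rw [keepIdx, not_not, hset] at h
  obtain ⟨_, ⟨i, hi, rfl⟩, hdvd⟩ := exists_monDvd_of_monElem_mem_span h
  exact ⟨i, hi, hdvd⟩

lemma keepIdx.not_monDvd {K : Type} [Field K] {n r k : ℕ} {μ : Fin k → ModMon n r}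
    {π : Fin k} {j : Fin n} (h : keepIdx K μ π j) {i : Fin k} (hi : i ≠ π) :
    ¬ monDvd (μ i) (smulMon (Finsupp.single j 1) (μ π)) := by
  rintro ⟨ν, hν⟩
  apply h
  rw [← hν, monElem_smulMon]
  exact Submodule.smul_mem _ _ (Submodule.subset_span ⟨i, hi, rfl⟩)

/-- With the setup of the base case: `⟨EG⟩ = Syz_{ker(λ)∩N}(F)`,
the pruned product `Q·G` is a minimal `≤`-Gröbner basis of `Syz_{ker(λ)∩N}(F)`,
and its leading monomials are `μᵢ` (`i ≠ π`) and `X_{jₛ} μ_π`. -/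
theorem statement10 {K : Type} [Field K] {n r s k : ℕ}
    (N : Submodule (MvPolynomial (Fin n) K) (Fin s → MvPolynomial (Fin n) K))
    (F : Fin r → Fin s → MvPolynomial (Fin n) K)
    (ord : ModMonomialOrder n r)
    (G : Fin k → Fin r → MvPolynomial (Fin n) K)
    (hG : IsMinimalGB ord (Syz N F) G)
    (μ : Fin k → ModMon n r) (hμ : ∀ i, IsLM ord (G i) (μ i))
    (lam : (Fin s → MvPolynomial (Fin n) K) →ₗ[K] K)
    (hker : ∀ (f : MvPolynomial (Fin n) K) (v : Fin s → MvPolynomial (Fin n) K),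
      v ∈ N → lam v = 0 → lam (f • v) = 0)
    (g : Fin k → Fin s → MvPolynomial (Fin n) K)
    (hg : ∀ i, g i = vecMulLin F (G i))
    (sord : ModMonomialOrder n k) (hs : IsSchreyerOrder ord μ sord)
    (π : Fin k) (hπ : lam (g π) ≠ 0)
    (hπmin : ∀ i : Fin k, lam (g i) ≠ 0 →
      sord.le ((0 : Fin n →₀ ℕ), π) ((0 : Fin n →₀ ℕ), i))
    (lamc : Fin k → K) (hlamc : ∀ i, i ≠ π → lamc i = - lam (g i) / lam (g π))
    (α : Fin n → K) (hα : ∀ j, α j = lam (fun c => X j * g π c) / lam (g π))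
    (S : Submodule (MvPolynomial (Fin n) K) (Fin r → MvPolynomial (Fin n) K))
    (hS : ∀ p : Fin r → MvPolynomial (Fin n) K,
      p ∈ S ↔ (vecMulLin F p ∈ N ∧ lam (vecMulLin F p) = 0)) :
    Submodule.span (MvPolynomial (Fin n) K)
        (Set.range (rowMul (elemRow π lamc α) G)) = S ∧
    IsMinimalGB ord S (rowMul (prunedRow π lamc α (keepIdx K μ π)) G) ∧
    (∀ (i : Fin k) (h : i ≠ π),
      IsLM ord (rowMul (prunedRow π lamc α (keepIdx K μ π)) G (Sum.inl ⟨i, h⟩))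
        (μ i)) ∧
    (∀ j : {j : Fin n // keepIdx K μ π j},
      IsLM ord (rowMul (prunedRow π lamc α (keepIdx K μ π)) G (Sum.inr j))
        (smulMon (Finsupp.single j.1 1) (μ π))) := by
  have hGM : ∀ i, vecMulLin F (G i) ∈ N := hG.1.1
  simp only [hg] at hπ hπmin hlamc hα
  have hsmul : ∀ (c : K) p, vecMulLin F (c • p) = c • vecMulLin F p := fun c p => by
    rw [← algebraMap_smul (MvPolynomial (Fin n) K) c p, map_smul, algebraMap_smul]
  have hα' : ∀ j, α j * lam (vecMulLin F (G π)) =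
      lam ((X j : MvPolynomial (Fin n) K) • vecMulLin F (G π)) := fun j => by
    rw [hα, div_mul_cancel₀ _ hπ]
    rfl
  have hnotdvd : ∀ {i j : Fin k}, i ≠ j → ¬ monDvd (μ i) (μ j) := fun hij =>
    hG.2 _ _ hij _ _ (hμ _) (hμ _)
  have hlt_of_lam_ne_zero : ∀ i, i ≠ π → lam (vecMulLin F (G i)) ≠ 0 →
      ord.lt (μ π) (μ i) := by
    intro i hi h
    have hne : μ π ≠ μ i := fun h' =>
      hnotdvd hi ⟨0, by simp [smulMon, h']⟩
    refine ⟨(ord.le_total _ _).resolve_right fun hle => hi ?_, hne⟩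
    have h1 := hs 0 0 i π (by simpa [smulMon] using ⟨hle, hne.symm⟩)
    exact congrArg Prod.snd (sord.le_antisymm _ _ h1 (hπmin i h))
  have hES : ∀ a, rowMul (elemRow π lamc α) G a ∈ S := by
    rintro (i | j)
    · rw [rowMul_elemRow_inl, hS, map_add, hsmul]
      refine ⟨N.add_mem (hGM _) (N.smul_of_tower_mem _ (hGM _)), ?_⟩
      rw [map_add, map_smul, hlamc _ i.2, smul_eq_mul, div_mul_cancel₀ _ hπ, add_neg_cancel]
    · rw [rowMul_elemRow_inr, hS, map_smul]
      refine ⟨N.smul_mem _ (hGM _), ?_⟩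
      rw [sub_smul, map_sub, ← hα' j, ← algebraMap_eq, algebraMap_smul, map_smul, smul_eq_mul,
        sub_self]
  have hlow : ∀ p ∈ Syz N F, ∀ ρ, IsLM ord p ρ → ord.lt ρ (μ π) →
      lam (vecMulLin F p) = 0 := by
    intro p hp ρ hρ hlt
    refine mem_addSubgroup_of_forall_exists_monDvd hμ hG.1.1
      (fun q hq ρ hρ => hG.1.exists_monDvd hμ hq hρ) (D := fun a => ord.lt a (μ π))
      (fun a b hab hb => ⟨ord.le_trans _ _ _ hab hb.1, ?_⟩)
      (A := (lam.toAddMonoidHom.comp (vecMulLin F).toAddMonoidHom).ker)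
      (fun i ν c h => ?_) ρ hlt p hp hρ
    · rintro rfl
      exact hb.2 (ord.le_antisymm _ _ hb.1 hab)
    · change lam (vecMulLin F (monomial ν c • G i)) = 0
      rw [map_smul]
      refine hker _ _ (hGM i) ?_
      by_contra hne
      have hle : ord.le (μ i) (smulMon ν (μ i)) := ord.le_of_monDvd ⟨ν, rfl⟩
      have hiπ : i ≠ π := by
        rintro rfl
        exact h.2 (ord.le_antisymm _ _ h.1 hle)
      exact h.2 (ord.le_antisymm _ _ h.1
        (ord.le_trans _ _ _ (hlt_of_lam_ne_zero i hiπ hne).1 hle))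
  have hnotLM : ∀ p ∈ S, ¬ IsLM ord p (μ π) := by
    intro p hp hLM
    rw [hS] at hp
    have hcπ := (hμ π).1
    set c := coeff (μ π).1 (p (μ π).2) / coeff (μ π).1 (G π (μ π).2) with hc
    have hc0 : c ≠ 0 := div_ne_zero hLM.1 hcπ
    have hq : lam (vecMulLin F (p - c • G π)) = 0 := by
      by_cases h0 : p - c • G π = 0
      · rw [h0, map_zero, map_zero]
      obtain ⟨ρ, hρ⟩ := exists_isLM ord h0
      refine hlow _ ?_ ρ hρ ⟨?_, ?_⟩
      · exact (Syz N F).sub_mem hp.1 ((Syz N F).smul_of_tower_mem c (hGM π))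
      · by_cases h1 : coeff ρ.1 (p ρ.2) = 0
        · refine (hμ π).2 _ _ fun h2 => hρ.1 ?_
          simp [h1, h2]
        · exact hLM.2 _ _ h1
      · rintro rfl
        apply hρ.1
        rw [Pi.sub_apply, Pi.smul_apply, coeff_sub, coeff_smul, hc, smul_eq_mul,
          div_mul_cancel₀ _ hcπ, sub_self]
    rw [map_sub, hsmul, map_sub, hp.2, map_smul, zero_sub, neg_eq_zero, smul_eq_mul] at hq
    exact mul_ne_zero hc0 hπ hq
  let μ' : ({i : Fin k // i ≠ π} ⊕ {j : Fin n // keepIdx K μ π j}) → ModMon n r :=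
    Sum.elim (fun i => μ i.1) (fun j => smulMon (Finsupp.single j.1 1) (μ π))
  have hμ' : ∀ a, IsLM ord (rowMul (prunedRow π lamc α (keepIdx K μ π)) G a) (μ' a) := by
    rintro (i | j)
    · rw [rowMul_prunedRow, Sum.map_inl, rowMul_elemRow_inl]
      refine (hμ i.1).add_smul (hμ π) fun h => hlt_of_lam_ne_zero i.1 i.2 fun h0 => h ?_
      rw [id, hlamc _ i.2, h0, neg_zero, zero_div]
    · rw [rowMul_prunedRow, Sum.map_inr, rowMul_elemRow_inr]
      exact (hμ π).X_sub_C_smul j.1 (α j.1)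
  have hQS : ∀ a, rowMul (prunedRow π lamc α (keepIdx K μ π)) G a ∈ S := fun a => by
    rw [rowMul_prunedRow]
    exact hES _
  have hdvd : ∀ p ∈ S, ∀ ρ, IsLM ord p ρ → ∃ a, monDvd (μ' a) ρ := by
    intro p hp ρ hρ
    obtain ⟨i, hi⟩ := hG.1.exists_monDvd hμ (p := p) ((hS p).1 hp).1 hρ
    by_cases hiπ : i = π
    · subst hiπ
      obtain ⟨ν, rfl⟩ := hi
      have hν : ν ≠ 0 := by
        rintro rfl
        exact hnotLM p hp (by simpa [smulMon] using hρ)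
      obtain ⟨j, hj⟩ := Finsupp.ne_iff.1 hν
      have hX : monDvd (smulMon (Finsupp.single j 1) (μ i)) (smulMon ν (μ i)) := by
        refine ⟨ν - Finsupp.single j 1, ?_⟩
        have : Finsupp.single j 1 ≤ ν := by
          simpa [Nat.one_le_iff_ne_zero] using hj
        simp [smulMon, ← add_assoc, tsub_add_cancel_of_le this]
      by_cases hkeep : keepIdx K μ i j
      · exact ⟨Sum.inr ⟨j, hkeep⟩, hX⟩
      · obtain ⟨l, hl, hl'⟩ := exists_monDvd_of_not_keepIdx hkeep
        exact ⟨Sum.inl ⟨l, hl⟩, monDvd_trans hl' hX⟩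
    · exact ⟨Sum.inl ⟨i, hiπ⟩, hi⟩
  refine ⟨le_antisymm (Submodule.span_le.2 (Set.range_subset_iff.2 hES)) ?_,
    ⟨isGB_of_forall_exists_monDvd hμ' hQS hdvd, ?_⟩, fun i h => hμ' (Sum.inl ⟨i, h⟩),
    fun j => hμ' (Sum.inr j)⟩
  · rw [← span_range_eq_of_forall_exists_monDvd hμ' hQS hdvd]
    refine Submodule.span_mono (Set.range_subset_iff.2 fun a => ?_)
    rw [rowMul_prunedRow]
    exact Set.mem_range_self _
  · intro a b hab μa μb ha hb
    rw [ha.unique (hμ' a), hb.unique (hμ' b)]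
    rcases a with i | j <;> rcases b with i' | j'
    · exact hnotdvd fun h => hab (congrArg Sum.inl (Subtype.ext h))
    · exact j'.2.not_monDvd i.2
    · exact fun h => hnotdvd i'.2.symm (monDvd_trans ⟨_, rfl⟩ h)
    · rintro ⟨ν, hν⟩
      have h1 : ν + Finsupp.single j.1 1 = Finsupp.single j'.1 1 := by
        have h2 := congrArg Prod.fst hν
        simp only [μ', Sum.elim_inr, smulMon, ← add_assoc] at h2
        exact add_right_cancel h2
      have h3 := DFunLike.congr_fun h1 j.1
      have hne : j'.1 ≠ j.1 := fun h => hab (congrArg Sum.inr (Subtype.ext h.symm))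
      simp [Finsupp.single_eq_of_ne hne.symm] at h3
end

section
/- Let j ∈ {1,…,n}, let δ₁,…,δ_j be positive integers, set m = ⌊δ_j/2⌋, and let I = ⟨X₁^{δ₁},…,X_{j−1}^{δ_{j−1}}, X_{j+1},…,Xₙ⟩ and J = I + ⟨X_j^{δ_j}⟩, monomial ideals of R. Let H ∈ R^{k×s} be a matrix each of whose entries lies in I + ⟨X_j^{m}⟩. Then each entry of the normal form of H modulo J (obtained by deleting all terms whose monomial lies in J) is divisible by X_j^{m}; let H₂ = X_j^{−m}·(H mod J) ∈ R^{k×s}. Then for every row vector p ∈ R^k: every entry of pH lies in J if and only if every entry of pH₂ lies in I + ⟨X_j^{⌈δ_j/2⌉}⟩. -/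
open MvPolynomial

open scoped Classical in
/-- The normal form of `f` modulo a monomial ideal `A`: delete from `f` all
terms whose monomial belongs to `A`. -/
noncomputable def normalForm {K : Type} [Field K] {n : ℕ}
    (A : Ideal (MvPolynomial (Fin n) K)) (f : MvPolynomial (Fin n) K) :
    MvPolynomial (Fin n) K :=
  ∑ m ∈ f.support.filter (fun m => monomial m (1 : K) ∉ A),
    monomial m (coeff m f)

theorem mem_sup_span_X_pow_iff {K : Type} [Field K] {n : ℕ} (j : Fin n) (δ : Fin n → ℕ) (t : ℕ)
    (f : MvPolynomial (Fin n) K) :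
    f ∈ Ideal.span
        ((fun i : Fin n => (X i : MvPolynomial (Fin n) K) ^ δ i) '' {i | i < j} ∪
          (fun i : Fin n => (X i : MvPolynomial (Fin n) K)) '' {i | j < i}) ⊔
        Ideal.span {(X j : MvPolynomial (Fin n) K) ^ t} ↔
      ∀ d, coeff d f ≠ 0 →
        (t ≤ d j ∨ (∃ i, i < j ∧ δ i ≤ d i) ∨ ∃ i, j < i ∧ 1 ≤ d i) := by
  have hspan : Ideal.span
        ((fun i : Fin n => (X i : MvPolynomial (Fin n) K) ^ δ i) '' {i | i < j} ∪
          (fun i : Fin n => (X i : MvPolynomial (Fin n) K)) '' {i | j < i}) ⊔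
        Ideal.span {(X j : MvPolynomial (Fin n) K) ^ t} =
      Ideal.span ((fun d => monomial d (1 : K)) ''
        (((fun i => Finsupp.single i (δ i)) '' {i | i < j} ∪
          (fun i => Finsupp.single i 1) '' {i | j < i}) ∪ {Finsupp.single j t})) := by
    rw [← Ideal.span_union]
    simp only [Set.image_union, Set.image_image, Set.image_singleton, X_pow_eq_monomial]
    rfl
  rw [hspan, mem_ideal_span_monomial_image]
  refine forall_congr' fun d => ?_
  rw [mem_support_iff]
  refine imp_congr_right fun _ => ?_
  constructor
  · rintro ⟨_, (⟨i, hi, rfl⟩ | ⟨i, hi, rfl⟩) | rfl, hd⟩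
    · exact Or.inr (Or.inl ⟨i, hi, Finsupp.single_le_iff.1 hd⟩)
    · exact Or.inr (Or.inr ⟨i, hi, Finsupp.single_le_iff.1 hd⟩)
    · exact Or.inl (Finsupp.single_le_iff.1 hd)
  · rintro (h | ⟨i, hi, h⟩ | ⟨i, hi, h⟩)
    · exact ⟨_, Or.inr rfl, Finsupp.single_le_iff.2 h⟩
    · exact ⟨_, Or.inl (Or.inl ⟨i, hi, rfl⟩), Finsupp.single_le_iff.2 h⟩
    · exact ⟨_, Or.inl (Or.inr ⟨i, hi, rfl⟩), Finsupp.single_le_iff.2 h⟩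

theorem X_pow_mul_mem_sup_span_X_pow_iff {K : Type} [Field K] {n : ℕ} (j : Fin n)
    (δ : Fin n → ℕ) (m t : ℕ) (g : MvPolynomial (Fin n) K) :
    X j ^ m * g ∈ Ideal.span
        ((fun i : Fin n => (X i : MvPolynomial (Fin n) K) ^ δ i) '' {i | i < j} ∪
          (fun i : Fin n => (X i : MvPolynomial (Fin n) K)) '' {i | j < i}) ⊔
        Ideal.span {(X j : MvPolynomial (Fin n) K) ^ (m + t)} ↔
      g ∈ Ideal.span
        ((fun i : Fin n => (X i : MvPolynomial (Fin n) K) ^ δ i) '' {i | i < j} ∪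
          (fun i : Fin n => (X i : MvPolynomial (Fin n) K)) '' {i | j < i}) ⊔
        Ideal.span {(X j : MvPolynomial (Fin n) K) ^ t} := by
  rw [mem_sup_span_X_pow_iff, mem_sup_span_X_pow_iff, X_pow_eq_monomial]
  constructor
  · intro h d hd
    have h' := h (Finsupp.single j m + d) (by rwa [coeff_monomial_mul, one_mul])
    refine h'.imp (fun h => ?_) (Or.imp ?_ ?_)
    · simpa using h
    · rintro ⟨i, hi, h⟩
      exact ⟨i, hi, by simpa [Finsupp.single_eq_of_ne hi.ne] using h⟩
    · rintro ⟨i, hi, h⟩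
      exact ⟨i, hi, by simpa [Finsupp.single_eq_of_ne hi.ne'] using h⟩
  · intro h d hd
    rw [coeff_monomial_mul', one_mul] at hd
    split_ifs at hd with hle
    · have hm : m ≤ d j := Finsupp.single_le_iff.1 hle
      refine (h _ hd).imp (fun h => ?_) (Or.imp ?_ ?_)
      · simp only [Finsupp.coe_tsub, Pi.sub_apply, Finsupp.single_eq_same] at h
        omega
      · rintro ⟨i, hi, h⟩
        exact ⟨i, hi, by simpa [Finsupp.single_eq_of_ne hi.ne] using h⟩
      · rintro ⟨i, hi, h⟩
        exact ⟨i, hi, by simpa [Finsupp.single_eq_of_ne hi.ne'] using h⟩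
    · exact absurd rfl hd

theorem sub_normalForm_mem {K : Type} [Field K] {n : ℕ}
    (A : Ideal (MvPolynomial (Fin n) K)) (f : MvPolynomial (Fin n) K) :
    f - normalForm A f ∈ A := by
  classical
  have h : f - normalForm A f =
      ∑ d ∈ f.support.filter (fun d => ¬ monomial d (1 : K) ∉ A), monomial d (coeff d f) := by
    rw [sub_eq_iff_eq_add', normalForm]
    conv_lhs => rw [f.as_sum]
    convert (Finset.sum_filter_add_sum_filter_not f.support
      (fun d => monomial d (1 : K) ∉ A) (fun d => monomial d (coeff d f))).symm
  rw [h]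
  refine A.sum_mem fun d hd => ?_
  have hd' := A.mul_mem_left (C (coeff d f)) (not_not.1 (Finset.mem_filter.1 hd).2)
  rwa [C_mul_monomial, mul_one] at hd'

/-- With `I = ⟨X₁^{δ₁},…,X_{j-1}^{δ_{j-1}}, X_{j+1},…,Xₙ⟩`,
`J = I + ⟨X_j^{δ_j}⟩` and `m = ⌊δ_j/2⌋`: if every entry of `H` lies in
`I + ⟨X_j^m⟩`, then every entry of the normal form of `H` modulo `J` is
divisible by `X_j^m`, and for `H₂ = X_j^{-m}·(H mod J)` and every row vector
`p`, `pH` has all entries in `J` iff `pH₂` has all entries in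
`I + ⟨X_j^{⌈δ_j/2⌉}⟩`. -/
theorem statement18 {K : Type} [Field K] {n s k : ℕ}
    (j : Fin n) (δ : Fin n → ℕ) (hδ : ∀ i : Fin n, i ≤ j → 0 < δ i)
    (I J : Ideal (MvPolynomial (Fin n) K))
    (hI : I = Ideal.span
      ((fun i : Fin n => (X i : MvPolynomial (Fin n) K) ^ δ i) '' {i | i < j} ∪
        (fun i : Fin n => (X i : MvPolynomial (Fin n) K)) '' {i | j < i}))
    (hJ : J = I ⊔ Ideal.span {(X j : MvPolynomial (Fin n) K) ^ δ j})
    (H : Fin k → Fin s → MvPolynomial (Fin n) K)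
    (hH : ∀ a c, H a c ∈ I ⊔ Ideal.span {(X j : MvPolynomial (Fin n) K) ^ (δ j / 2)}) :
    (∀ a c, (X j : MvPolynomial (Fin n) K) ^ (δ j / 2) ∣ normalForm J (H a c)) ∧
    (∀ H₂ : Fin k → Fin s → MvPolynomial (Fin n) K,
      (∀ a c, normalForm J (H a c) =
        (X j : MvPolynomial (Fin n) K) ^ (δ j / 2) * H₂ a c) →
      ∀ p : Fin k → MvPolynomial (Fin n) K,
        (∀ c, (∑ a, p a * H a c) ∈ J) ↔
        (∀ c, (∑ a, p a * H₂ a c) ∈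
          I ⊔ Ideal.span {(X j : MvPolynomial (Fin n) K) ^ ((δ j + 1) / 2)})) := by
  classical
  subst hI
  subst hJ
  refine ⟨fun a c => ?_, fun H₂ hH₂ p => forall_congr' fun c => ?_⟩
  · refine Finset.dvd_sum fun d hd => ?_
    obtain ⟨hd, hdJ⟩ := Finset.mem_filter.1 hd
    have hm : δ j / 2 ≤ d j := by
      refine ((mem_sup_span_X_pow_iff ..).1 (hH a c) d (mem_support_iff.1 hd)).resolve_right
        fun h => hdJ ((mem_sup_span_X_pow_iff ..).2 fun e he => Or.inr ?_)
      rw [coeff_monomial] at he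
      split_ifs at he with hde
      · exact hde ▸ h
      · exact absurd rfl he
    refine ⟨monomial (d - Finsupp.single j (δ j / 2)) (coeff d (H a c)), ?_⟩
    rw [X_pow_eq_monomial, monomial_mul, one_mul,
      add_tsub_cancel_of_le (Finsupp.single_le_iff.2 hm)]
  · have hδj : δ j = δ j / 2 + (δ j + 1) / 2 := by omega
    generalize hJ : _ ⊔ Ideal.span {(X j : MvPolynomial (Fin n) K) ^ δ j} = J at hH₂ ⊢
    have hsub : ∑ a, p a * H a c - X j ^ (δ j / 2) * ∑ a, p a * H₂ a c ∈ J := by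
      rw [Finset.mul_sum, ← Finset.sum_sub_distrib]
      refine J.sum_mem fun a _ => ?_
      rw [mul_left_comm, ← hH₂, ← mul_sub]
      exact J.mul_mem_left _ (sub_normalForm_mem J _)
    rw [← X_pow_mul_mem_sup_span_X_pow_iff j δ (δ j / 2), ← hδj, hJ]
    exact ⟨fun h => (Submodule.sub_mem_iff_right J h).1 hsub, fun h => (Submodule.sub_mem_iff_left J h).1 hsub⟩
end
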